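/- Fix an aperture α > 0. For any decreasing function s : (0,∞) → (0,∞) with lim_{t→∞} s(t) = 0 and ∫₁^∞ s(t) dt = +∞, there exists a positive superharmonic function φ on the upper half-plane U₊ such that |{ξ ∈ ℝ : Mφ(ξ) > t}| ≤ s(t) for all sufficiently large t > 0, but there exists no harmonic function h on U₊ with h(z) ≥ φ(z) for all z ∈ U₊. -/

import Mathlib

open MeasureTheory Filter Set

noncomputable section

/-- The upper half-plane. -/
def upperHalf : Set ℂ := {z : ℂ | 0 < z.im}

/-- A function is harmonic on `D` if it is continuous there and satisfies the mean value
equality over every circle whose closed disk is contained in `D`. -/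
def HarmonicOnD (h : ℂ → ℝ) (D : Set ℂ) : Prop :=
  ContinuousOn h D ∧
  ∀ z ∈ D, ∀ r : ℝ, 0 < r → Metric.closedBall z r ⊆ D →
    h z = (2 * Real.pi)⁻¹ * ∫ θ in (0:ℝ)..(2 * Real.pi), h (z + r * Complex.exp (θ * Complex.I))

/-- A function is superharmonic on `D` if it is lower semicontinuous there and satisfies the
super-mean-value inequality over every circle whose closed disk is contained in `D`. -/
def SuperharmonicOnD (u : ℂ → ℝ) (D : Set ℂ) : Prop :=
  LowerSemicontinuousOn u D ∧
  ∀ z ∈ D, ∀ r : ℝ, 0 < r → Metric.closedBall z r ⊆ D →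
    (2 * Real.pi)⁻¹ * (∫ θ in (0:ℝ)..(2 * Real.pi), u (z + r * Complex.exp (θ * Complex.I))) ≤ u z

/-- The Stolz angle with aperture `α` and vertex at the boundary point `t ∈ ℝ`. -/
def stolz (α t : ℝ) : Set ℂ := {z : ℂ | 0 < z.im ∧ |z.re - t| ≤ α * z.im}

lemma psi_polar (r θ : ℝ) : (Complex.polarCoord.symm (r, θ)) = r * Complex.exp (θ * Complex.I) := by
  rw [Complex.polarCoord_symm_apply, Complex.exp_mul_I]
  simp

lemma area_mean {h : ℂ → ℝ} (hh : HarmonicOnD h upperHalf) {z : ℂ} (hz : z ∈ upperHalf) {R : ℝ}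
    (hR : 0 < R) (hb : Metric.closedBall z R ⊆ upperHalf) :
    ∫ w in Metric.ball z R, h w = Real.pi * R ^ 2 * h z := by
  have e1 : ∫ w in Metric.ball z R, h w
      = ∫ w, (Metric.ball (0:ℂ) R).indicator (fun w => h (z + w)) w := by
    rw [← integral_indicator Metric.isOpen_ball.measurableSet,
      ← integral_add_left_eq_self _ z]
    congr 1
    ext w
    by_cases hw : w ∈ Metric.ball (0:ℂ) R
    · rw [indicator_of_mem hw, indicator_of_mem]
      simpa using hw
    · rw [indicator_of_notMem hw, indicator_of_notMem]
      simpa using hw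
  have hcont : ContinuousOn (fun p : ℝ × ℝ => p.1 * h (z + p.1 * Complex.exp (p.2 * Complex.I)))
      (Icc 0 R ×ˢ Icc (-Real.pi) Real.pi) := by
    apply ContinuousOn.mul (by fun_prop)
    apply hh.1.comp (by fun_prop)
    rintro ⟨r, θ⟩ ⟨h1, h2⟩
    apply hb
    simp [Complex.norm_exp_ofReal_mul_I, abs_of_nonneg h1.1]
    exact h1.2
  have hIntg : IntegrableOn (fun p : ℝ × ℝ => p.1 * h (z + p.1 * Complex.exp (p.2 * Complex.I)))
      (Ioo 0 R ×ˢ Ioo (-Real.pi) Real.pi) :=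
    (hcont.integrableOn_compact (isCompact_Icc.prod isCompact_Icc)).mono_set
      (prod_mono Ioo_subset_Icc_self Ioo_subset_Icc_self)
  have e2 : ∫ w, (Metric.ball (0:ℂ) R).indicator (fun w => h (z + w)) w
      = ∫ p in Ioo 0 R ×ˢ Ioo (-Real.pi) Real.pi,
          p.1 * h (z + p.1 * Complex.exp (p.2 * Complex.I)) := by
    rw [← Complex.integral_comp_polarCoord_symm, polarCoord_target,
      ← integral_indicator (measurableSet_Ioi.prod measurableSet_Ioo),
      ← integral_indicator (measurableSet_Ioo.prod measurableSet_Ioo)]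
    congr 1
    ext ⟨r, θ⟩
    by_cases h1 : (r, θ) ∈ Ioi (0:ℝ) ×ˢ Ioo (-Real.pi) Real.pi
    · have hr : 0 < r := h1.1
      rw [indicator_of_mem h1, psi_polar]
      by_cases h2 : r < R
      · have h3 : (r, θ) ∈ Ioo 0 R ×ˢ Ioo (-Real.pi) Real.pi := ⟨⟨hr, h2⟩, h1.2⟩
        rw [indicator_of_mem (by simp [abs_of_pos hr, h2]), indicator_of_mem h3]
        rfl
      · rw [indicator_of_notMem (by simp [abs_of_pos hr]; linarith),
          indicator_of_notMem (fun h3 => h2 h3.1.2)]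
        simp
    · rw [indicator_of_notMem h1, indicator_of_notMem (fun h3 => h1 ⟨h3.1.1, h3.2⟩)]
  have e3 : ∀ r ∈ Ioo 0 R, ∫ θ in Ioo (-Real.pi) Real.pi,
      r * h (z + r * Complex.exp (θ * Complex.I)) = r * (2 * Real.pi * h z) := by
    intro r hr
    rw [MeasureTheory.integral_const_mul]
    congr 1
    have hp : Function.Periodic (fun θ : ℝ => h (z + r * Complex.exp (θ * Complex.I)))
        (2 * Real.pi) := by
      intro θ
      have : Complex.exp (((θ + 2 * Real.pi : ℝ) : ℂ) * Complex.I)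
          = Complex.exp (θ * Complex.I) := by
        push_cast
        rw [add_mul, Complex.exp_add, Complex.exp_two_pi_mul_I, mul_one]
      simp only [this]
    rw [← integral_Ioc_eq_integral_Ioo, ← intervalIntegral.integral_of_le (by linarith [Real.pi_pos])]
    have := hp.intervalIntegral_add_eq (-Real.pi) 0
    rw [show -Real.pi + 2 * Real.pi = Real.pi by ring, zero_add] at this
    rw [this]
    have := hh.2 z hz r hr.1 ((Metric.closedBall_subset_closedBall hr.2.le).trans hb)
    rw [this, ← mul_assoc, mul_inv_cancel₀ (by positivity), one_mul]
  rw [e1, e2, Measure.volume_eq_prod, setIntegral_prod _ hIntg, setIntegral_congr_fun measurableSet_Ioo e3,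
    ← integral_Ioc_eq_integral_Ioo, ← intervalIntegral.integral_of_le hR.le,
    intervalIntegral.integral_mul_const, integral_id]
  ring

lemma ball_sum {h : ℂ → ℝ} (hh : HarmonicOnD h upperHalf) (h0 : ∀ z ∈ upperHalf, 0 ≤ h z)
    {d : ℝ} (hd : 0 < d) (hd' : d < 1 / 3) {ι : Type*} (F : Finset ι) (w : ι → ℂ) (T : ι → ℝ)
    (hw : ∀ i ∈ F, ‖w i - Complex.I‖ = 1 - 2 * d)
    (hT : ∀ i ∈ F, T i ≤ h (w i))
    (hsep : ∀ i ∈ F, ∀ j ∈ F, i ≠ j → 2 * d ≤ ‖w i - w j‖) :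
    ∑ i ∈ F, T i * d ≤ 4 * h Complex.I := by
  have hI : Complex.I ∈ upperHalf := by simp [upperHalf]
  have hB : Metric.closedBall Complex.I (1 - d) ⊆ upperHalf := by
    intro z hz
    rw [mem_closedBall_iff_norm] at hz
    have := (abs_le.1 ((Complex.abs_im_le_norm (z - Complex.I)).trans hz)).1
    simp at this
    simp only [upperHalf, mem_ofPred_eq]
    linarith
  have hbi : ∀ i ∈ F, Metric.closedBall (w i) d ⊆ Metric.closedBall Complex.I (1 - d) := by
    intro i hi z hz
    rw [mem_closedBall_iff_norm] at hz ⊢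
    have : z - Complex.I = (z - w i) + (w i - Complex.I) := by ring
    rw [this]
    refine (norm_add_le _ _).trans ?_
    rw [hw i hi]; linarith
  have hIntg : IntegrableOn h (Metric.closedBall Complex.I (1 - d)) :=
    (hh.1.mono hB).integrableOn_compact (isCompact_closedBall _ _)
  set A := ⋃ i ∈ F, Metric.ball (w i) d with hA
  have hAsub : A ⊆ Metric.ball Complex.I (1 - d) \ Metric.ball Complex.I (1 - 3 * d) := by
    intro z hz
    simp only [hA, mem_iUnion, exists_prop] at hz
    obtain ⟨i, hi, hz⟩ := hz
    rw [mem_ball_iff_norm] at hz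
    have e1 : z - Complex.I = (z - w i) + (w i - Complex.I) := by ring
    have e2 : w i - Complex.I = (z - Complex.I) - (z - w i) := by ring
    constructor
    · rw [mem_ball_iff_norm, e1]
      refine (norm_add_le _ _).trans_lt ?_
      rw [hw i hi]; linarith
    · rw [mem_ball_iff_norm, not_lt]
      have := norm_sub_le (z - Complex.I) (z - w i)
      rw [← e2, hw i hi] at this
      linarith
  have hAm : ∫ z in A, h z = ∑ i ∈ F, Real.pi * d ^ 2 * h (w i) := by
    rw [hA, integral_biUnion_finset]
    · refine Finset.sum_congr rfl fun i hi => area_mean hh ?_ hd ((hbi i hi).trans hB)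
      exact hB (hbi i hi (Metric.mem_closedBall_self hd.le))
    · exact fun i _ => Metric.isOpen_ball.measurableSet
    · intro i hi j hj hij
      apply Metric.ball_disjoint_ball
      rw [dist_eq_norm]
      linarith [hsep i hi j hj hij]
    · intro i hi
      exact hIntg.mono_set (Metric.ball_subset_closedBall.trans (hbi i hi))
  have hle : ∫ z in A, h z
      ≤ ∫ z in Metric.ball Complex.I (1 - d) \ Metric.ball Complex.I (1 - 3 * d), h z := by
    apply setIntegral_mono_set
    · exact hIntg.mono_set (sdiff_subset.trans Metric.ball_subset_closedBall)
    · refine (ae_restrict_iff' (Metric.isOpen_ball.measurableSet.diff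
        Metric.isOpen_ball.measurableSet)).2 (Eventually.of_forall fun z hz => ?_)
      exact h0 z (hB (Metric.ball_subset_closedBall hz.1))
    · exact hAsub.eventuallyLE
  have hsub : Metric.ball Complex.I (1 - 3 * d) ⊆ Metric.ball Complex.I (1 - d) :=
    Metric.ball_subset_ball (by linarith)
  rw [setIntegral_sdiff Metric.isOpen_ball.measurableSet
    (hIntg.mono_set Metric.ball_subset_closedBall) hsub, hAm,
    area_mean hh hI (by linarith) hB, area_mean hh hI (by linarith)
      ((Metric.closedBall_subset_closedBall (by linarith)).trans hB)] at hle
  have h1 : Real.pi * d * ∑ i ∈ F, T i * d ≤ ∑ i ∈ F, Real.pi * d ^ 2 * h (w i) := by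
    rw [Finset.mul_sum]
    refine Finset.sum_le_sum fun i hi => ?_
    have := mul_le_mul_of_nonneg_left (hT i hi) (by positivity : 0 ≤ Real.pi * d ^ 2)
    nlinarith
  have hpd : 0 < Real.pi * d := by positivity
  have h2 : Real.pi * d * ∑ i ∈ F, T i * d ≤ Real.pi * d * (4 * h Complex.I) := by
    have := h0 _ hI
    have : 0 ≤ Real.pi * d * d * h Complex.I := by positivity
    nlinarith
  exact le_of_mul_le_mul_left h2 hpd

/-- Truncated Green function of the upper half-plane. -/
def psi (w : ℂ) (T c : ℝ) (z : ℂ) : ℝ :=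
  -c * Real.log (max (‖z - w‖ / ‖z - (starRingEnd ℂ) w‖) (Real.exp (-T / c)))

lemma conj_dist_pos {w z : ℂ} (hw : w ∈ upperHalf) (hz : z ∈ upperHalf) :
    0 < ‖z - (starRingEnd ℂ) w‖ := by
  rw [norm_pos_iff]
  intro h
  have := congrArg Complex.im h
  simp [upperHalf] at this hw hz
  linarith

lemma dist_le_conj {w z : ℂ} (hw : w ∈ upperHalf) (hz : z ∈ upperHalf) :
    ‖z - w‖ ≤ ‖z - (starRingEnd ℂ) w‖ := by
  rw [Complex.norm_def, Complex.norm_def]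
  apply Real.sqrt_le_sqrt
  simp only [Complex.normSq_apply, Complex.sub_re, Complex.sub_im, Complex.conj_re,
    Complex.conj_im]
  simp only [upperHalf, mem_ofPred_eq] at hw hz
  nlinarith [mul_pos hw hz]

lemma psi_cont {w : ℂ} (hw : w ∈ upperHalf) (T c : ℝ) : ContinuousOn (psi w T c) upperHalf := by
  unfold psi
  apply ContinuousOn.mul continuousOn_const
  apply ContinuousOn.log
  · refine ContinuousOn.sup ?_ continuousOn_const
    apply ContinuousOn.div (by fun_prop) (by fun_prop)
    exact fun z hz => (conj_dist_pos hw hz).ne'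
  · exact fun z hz => (lt_max_of_lt_right (Real.exp_pos _)).ne'

lemma psi_nonneg {w z : ℂ} (hw : w ∈ upperHalf) (hz : z ∈ upperHalf) {T c : ℝ} (hT : 0 ≤ T)
    (hc : 0 < c) : 0 ≤ psi w T c z := by
  unfold psi
  have : Real.log (max (‖z - w‖ / ‖z - (starRingEnd ℂ) w‖) (Real.exp (-T / c))) ≤ 0 := by
    apply Real.log_nonpos (le_max_of_le_right (Real.exp_pos _).le)
    apply max_le
    · rw [div_le_one (conj_dist_pos hw hz)]
      exact dist_le_conj hw hz
    · rw [Real.exp_le_one_iff]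
      exact div_nonpos_of_nonpos_of_nonneg (by linarith) hc.le
  nlinarith

lemma psi_le {w z : ℂ} {T c : ℝ} (hc : 0 < c) : psi w T c z ≤ T := by
  unfold psi
  have : -T / c ≤ Real.log (max (‖z - w‖ / ‖z - (starRingEnd ℂ) w‖) (Real.exp (-T / c))) := by
    rw [Real.le_log_iff_exp_le (lt_max_of_lt_right (Real.exp_pos _))]
    exact le_max_right _ _
  rw [div_le_iff₀ hc] at this
  nlinarith

lemma psi_self {w : ℂ} {T c : ℝ} (hc : 0 < c) : psi w T c w = T := by
  unfold psi
  rw [sub_self, norm_zero, zero_div, max_eq_right (Real.exp_pos _).le, Real.log_exp]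
  field_simp

lemma psi_le_green {w z : ℂ} (hw : w ∈ upperHalf) (hz : z ∈ upperHalf) (hzw : z ≠ w) {T c : ℝ}
    (hc : 0 < c) :
    psi w T c z ≤ c * (Real.log ‖z - (starRingEnd ℂ) w‖ - Real.log ‖z - w‖) := by
  unfold psi
  have hp : 0 < ‖z - w‖ := norm_pos_iff.2 (sub_ne_zero.2 hzw)
  have hq := conj_dist_pos hw hz
  have : Real.log (‖z - w‖ / ‖z - (starRingEnd ℂ) w‖) ≤
    Real.log (max (‖z - w‖ / ‖z - (starRingEnd ℂ) w‖) (Real.exp (-T / c))) :=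
    Real.log_le_log (by positivity) (le_max_left _ _)
  rw [Real.log_div hp.ne' hq.ne'] at this
  nlinarith

lemma psi_small {w z : ℂ} (hw : w ∈ upperHalf) (hz : z ∈ upperHalf) {T c δ : ℝ}
    (hc : 0 < c) (hδ : 0 < δ) (hd : δ ≤ ‖z - w‖) : psi w T c z ≤ c * (2 * w.im / δ) := by
  have hp : 0 < ‖z - w‖ := by linarith
  have hzw : z ≠ w := by
    rintro rfl
    simp at hp
  have hq := conj_dist_pos hw hz
  refine (psi_le_green hw hz hzw hc).trans (mul_le_mul_of_nonneg_left ?_ hc.le)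
  rw [← Real.log_div hq.ne' hp.ne']
  refine (Real.log_le_sub_one_of_pos (by positivity)).trans ?_
  have hwi : 0 < w.im := hw
  have h1 : ‖z - (starRingEnd ℂ) w‖ ≤ ‖z - w‖ + 2 * w.im := by
    have e : z - (starRingEnd ℂ) w = (z - w) + (w - (starRingEnd ℂ) w) := by ring
    rw [e]
    refine (norm_add_le _ _).trans ?_
    have : w - (starRingEnd ℂ) w = ((2 * w.im : ℝ) : ℂ) * Complex.I := by
      rw [Complex.sub_conj]
    rw [this, norm_mul, Complex.norm_I, mul_one, Complex.norm_real, Real.norm_eq_abs,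
      abs_of_pos (by linarith)]
  calc ‖z - (starRingEnd ℂ) w‖ / ‖z - w‖ - 1 ≤ (‖z - w‖ + 2 * w.im) / ‖z - w‖ - 1 := by gcongr
    _ = 2 * w.im / ‖z - w‖ := by field_simp; ring
    _ ≤ 2 * w.im / δ := by gcongr

lemma circ_mem {z : ℂ} {r : ℝ} (hr : 0 < r) (hb : Metric.closedBall z r ⊆ upperHalf) (θ : ℝ) :
    z + r * Complex.exp (θ * Complex.I) ∈ upperHalf := by
  apply hb
  simp [Complex.norm_exp_ofReal_mul_I, abs_of_pos hr]

lemma psi_circ_cont {w : ℂ} (hw : w ∈ upperHalf) (T c : ℝ) {z : ℂ} {r : ℝ} (hr : 0 < r)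
    (hb : Metric.closedBall z r ⊆ upperHalf) :
    Continuous (fun θ : ℝ => psi w T c (z + r * Complex.exp (θ * Complex.I))) := by
  rw [← continuousOn_univ]
  apply (psi_cont hw T c).comp (by fun_prop)
  exact fun θ _ => circ_mem hr hb θ

lemma psi_mean {w : ℂ} (hw : w ∈ upperHalf) {T c : ℝ}
    (hc : 0 < c) {z : ℂ} {r : ℝ} (hr : 0 < r) (hb : Metric.closedBall z r ⊆ upperHalf) :
    ∫ θ in (0:ℝ)..(2 * Real.pi), psi w T c (z + r * Complex.exp (θ * Complex.I))
      ≤ 2 * Real.pi * psi w T c z := by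
  have hz : z ∈ upperHalf := hb (Metric.mem_closedBall_self hr.le)
  have hi := (psi_circ_cont hw T c hr hb).intervalIntegrable (μ := volume) 0 (2 * Real.pi)
  have hpi : 0 < 2 * Real.pi := by positivity
  have b1 : ∫ θ in (0:ℝ)..(2 * Real.pi), psi w T c (z + r * Complex.exp (θ * Complex.I))
      ≤ 2 * Real.pi * T := by
    have := intervalIntegral.integral_mono_on hpi.le hi
      (intervalIntegrable_const (c := T)) (fun θ _ => psi_le hc)
    simpa using this
  by_cases hzw : z = w
  · have e : psi w T c z = T := by rw [hzw, psi_self hc]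
    rwa [e]
  set a := (starRingEnd ℂ) w with ha
  have hia : CircleIntegrable (fun x => Real.log ‖x - a‖) z r := circleIntegrable_log_norm_sub_const r
  have hiw : CircleIntegrable (fun x => Real.log ‖x - w‖) z r := circleIntegrable_log_norm_sub_const r
  have hza : r < ‖z - a‖ := by
    by_contra hcon
    have : a ∈ upperHalf := hb (by
      rw [mem_closedBall_iff_norm, norm_sub_rev]; linarith)
    simp [upperHalf, ha] at this hw
    linarith
  have avA : Real.circleAverage (fun x => Real.log ‖x - a‖) z r = Real.log ‖z - a‖ := by
    rw [circleAverage_log_norm_sub_const_eq_log_radius_add_posLog hr.ne', Real.posLog_eq_log,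
      Real.log_mul (by positivity) (by linarith), Real.log_inv]
    · ring
    · rw [abs_of_pos (by have := hr.trans hza; positivity), inv_mul_eq_div, le_div_iff₀ hr]
      linarith
  have hp : 0 < ‖z - w‖ := norm_pos_iff.2 (sub_ne_zero.2 hzw)
  have avW : Real.log ‖z - w‖ ≤ Real.circleAverage (fun x => Real.log ‖x - w‖) z r := by
    rw [circleAverage_log_norm_sub_const_eq_log_radius_add_posLog hr.ne']
    have : Real.log (r⁻¹ * ‖z - w‖) ≤ Real.posLog (r⁻¹ * ‖z - w‖) := le_max_right 0 _
    rw [Real.log_mul (by positivity) hp.ne', Real.log_inv] at this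
    linarith
  have b2 : ∫ θ in (0:ℝ)..(2 * Real.pi), psi w T c (z + r * Complex.exp (θ * Complex.I))
      ≤ 2 * Real.pi * (c * (Real.log ‖z - a‖ - Real.log ‖z - w‖)) := by
    have h1 : ∫ θ in (0:ℝ)..(2 * Real.pi), psi w T c (z + r * Complex.exp (θ * Complex.I))
      ≤ ∫ θ in (0:ℝ)..(2 * Real.pi), c * (Real.log ‖circleMap z r θ - a‖
          - Real.log ‖circleMap z r θ - w‖) := by
      apply intervalIntegral.integral_mono_ae hpi.le hi ((hia.sub hiw).const_mul c)
      have : (circleMap z r ⁻¹' {w}).Countable :=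
        (countable_singleton w).preimage_circleMap z hr.ne'
      filter_upwards [this.ae_notMem volume] with θ hθ
      exact psi_le_green hw (circ_mem hr hb θ) hθ hc
    refine h1.trans ?_
    rw [intervalIntegral.integral_const_mul, intervalIntegral.integral_sub hia hiw]
    rw [Real.circleAverage_def, smul_eq_mul] at avA avW
    have e : ∀ x : ℝ, x = 2 * Real.pi * ((2 * Real.pi)⁻¹ * x) := fun x => by field_simp
    rw [e (∫ θ in (0:ℝ)..(2 * Real.pi), Real.log ‖circleMap z r θ - a‖),
      e (∫ θ in (0:ℝ)..(2 * Real.pi), Real.log ‖circleMap z r θ - w‖), avA]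
    have : 0 < 2 * Real.pi * c := by positivity
    nlinarith
  have : psi w T c z = min T (c * (Real.log ‖z - a‖ - Real.log ‖z - w‖)) := by
    unfold psi
    have hq := conj_dist_pos hw hz
    rcases le_total (‖z - w‖ / ‖z - a‖) (Real.exp (-T / c)) with hle | hle
    · rw [max_eq_right hle, Real.log_exp, min_eq_left]
      · field_simp
      · rw [← Real.log_le_iff_le_exp (by positivity), Real.log_div hp.ne' hq.ne',
          le_div_iff₀ hc] at hle
        linarith
    · rw [max_eq_left hle, Real.log_div hp.ne' hq.ne', min_eq_right]
      · ring
      · rw [← Real.le_log_iff_exp_le (by positivity), Real.log_div hp.ne' hq.ne',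
          div_le_iff₀ hc] at hle
        linarith
  rw [this, mul_min_of_nonneg _ _ hpi.le]
  exact le_min b1 b2

lemma build {ι : Type*} [Countable ι] (w : ι → ℂ) (hw : ∀ i, w i ∈ upperHalf) (T δ : ι → ℝ)
    (hT : ∀ i, 0 ≤ T i) (hδ : ∀ i, 0 < δ i)
    (hdis : ∀ i j z, 0 < T i → 0 < T j → ‖z - w i‖ < δ i → ‖z - w j‖ < δ j → i = j) :
    ∃ φ : ℂ → ℝ, SuperharmonicOnD φ upperHalf ∧ (∀ z ∈ upperHalf, 0 < φ z) ∧
      (∀ i, T i ≤ φ (w i)) ∧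
      ∀ z ∈ upperHalf, 2 < φ z → ∃ i, 0 < T i ∧ ‖z - w i‖ < δ i ∧ φ z ≤ T i + 2 := by
  classical
  obtain ⟨e, he, E, hE, hE1⟩ := NNReal.exists_pos_sum_of_countable one_ne_zero ι
  have hEr : HasSum (fun i => (e i : ℝ)) (E : ℝ) := NNReal.hasSum_coe.2 hE
  set c : ι → ℝ := fun i => e i * (δ i / (2 * (w i).im)) with hcdef
  have hwi : ∀ i, 0 < (w i).im := hw
  have hc : ∀ i, 0 < c i := fun i => by
    have := he i
    have := hδ i
    have := hwi i
    positivity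
  set p : ι → ℂ → ℝ := fun i => psi (w i) (T i) (c i) with hpdef
  have p0 : ∀ i, ∀ z ∈ upperHalf, 0 ≤ p i z := fun i z hz => psi_nonneg (hw i) hz (hT i) (hc i)
  have pout : ∀ i, ∀ z ∈ upperHalf, (0 < T i → δ i ≤ ‖z - w i‖) → p i z ≤ e i := by
    intro i z hz h
    rcases (hT i).lt_or_eq with h1 | h1
    · refine (psi_small (hw i) hz (hc i) (hδ i) (h h1)).trans (le_of_eq ?_)
      have := (hδ i).ne'
      have := (hwi i).ne'
      simp only [hcdef]
      field_simp
    · refine (psi_le (hc i)).trans ?_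
      rw [← h1]
      exact (e i).2
  have psum : ∀ z ∈ upperHalf, ∃ B : ℝ, Summable (fun i => p i z) ∧ ∑' i, p i z ≤ B ∧
      (1 < ∑' i, p i z → ∃ i, 0 < T i ∧ ‖z - w i‖ < δ i ∧ ∑' i, p i z ≤ T i + 1) := by
    intro z hz
    by_cases hex : ∃ i, 0 < T i ∧ ‖z - w i‖ < δ i
    · obtain ⟨i, hi1, hi2⟩ := hex
      have hle : ∀ j, p j z ≤ e j + (if j = i then T i else 0) := by
        intro j
        by_cases hj : j = i
        · subst hj
          rw [if_pos rfl]
          have : p j z ≤ T j := psi_le (hc j)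
          have := (e j).2
          linarith
        · rw [if_neg hj, add_zero]
          apply pout j z hz
          intro hTj
          by_contra hcon
          exact hj (hdis j i z hTj hi1 (not_le.1 hcon) hi2)
      have hs2 : HasSum (fun j => (e j : ℝ) + (if j = i then T i else 0)) (E + T i) :=
        hEr.add (hasSum_ite_eq i (T i))
      have hs : Summable (fun i => p i z) :=
        Summable.of_nonneg_of_le (fun j => p0 j z hz) hle hs2.summable
      have hb : ∑' i, p i z ≤ E + T i := by
        rw [← hs2.tsum_eq]
        exact hs.tsum_le_tsum hle hs2.summable
      have : (E : ℝ) < 1 := hE1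
      exact ⟨_, hs, hb, fun _ => ⟨i, hi1, hi2, by linarith⟩⟩
    · push Not at hex
      have hle : ∀ j, p j z ≤ e j := fun j => pout j z hz (hex j)
      have hs : Summable (fun i => p i z) :=
        Summable.of_nonneg_of_le (fun j => p0 j z hz) hle hEr.summable
      have hb : ∑' i, p i z ≤ E := by
        rw [← hEr.tsum_eq]
        exact hs.tsum_le_tsum hle hEr.summable
      have : (E : ℝ) < 1 := hE1
      exact ⟨_, hs, hb, fun h => absurd h (by linarith)⟩
  have hs : ∀ z ∈ upperHalf, Summable (fun i => p i z) := fun z hz => (psum z hz).choose_spec.1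
  refine ⟨fun z => 1 + ∑' i, p i z, ⟨?_, ?_⟩, ?_, ?_, ?_⟩
  · intro z hz y hy
    have ht : Tendsto (fun F : Finset ι => 1 + ∑ i ∈ F, p i z) atTop (nhds (1 + ∑' i, p i z)) :=
      (hs z hz).hasSum.const_add 1
    obtain ⟨F, hF⟩ := (ht.eventually (lt_mem_nhds hy)).exists
    have hcF : ContinuousOn (fun z => 1 + ∑ i ∈ F, p i z) upperHalf :=
      continuousOn_const.add (continuousOn_finsetSum _ fun i _ => psi_cont (hw i) _ _)
    filter_upwards [(hcF z hz).eventually (lt_mem_nhds hF), self_mem_nhdsWithin] with x hx hxu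
    have := (hs x hxu).sum_le_tsum F (fun i _ => p0 i x hxu)
    linarith
  · intro z hz r hr hb
    have hpi : 0 < 2 * Real.pi := by positivity
    rw [inv_mul_le_iff₀ hpi]
    have hmem := circ_mem hr hb
    have hnn : 0 ≤ ∑' i, p i z := tsum_nonneg fun i => p0 i z hz
    rw [intervalIntegral.integral_of_le hpi.le]
    by_cases hIntg : Integrable (fun θ : ℝ => 1 + ∑' i, p i (z + r * Complex.exp (θ * Complex.I)))
      (volume.restrict (Ioc 0 (2 * Real.pi)))
    swap
    · rw [integral_undef hIntg]
      positivity
    have hIntg2 : Integrable (fun θ : ℝ => ∑' i, p i (z + r * Complex.exp (θ * Complex.I)))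
      (volume.restrict (Ioc 0 (2 * Real.pi))) := by
      refine (hIntg.sub (integrable_const (1:ℝ))).congr (Eventually.of_forall fun θ => ?_)
      simp
    rw [integral_add (integrable_const _) hIntg2]
    have key : ∫ θ in Ioc 0 (2 * Real.pi), ∑' i, p i (z + r * Complex.exp (θ * Complex.I))
        ≤ 2 * Real.pi * ∑' i, p i z := by
      rw [← ENNReal.ofReal_le_ofReal_iff (by positivity),
        ofReal_integral_eq_lintegral_ofReal hIntg2
          (Eventually.of_forall fun θ => tsum_nonneg fun i => p0 i _ (hmem θ))]
      calc ∫⁻ θ in Ioc 0 (2 * Real.pi),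
            ENNReal.ofReal (∑' i, p i (z + r * Complex.exp (θ * Complex.I)))
          = ∫⁻ θ in Ioc 0 (2 * Real.pi),
            ∑' i, ENNReal.ofReal (p i (z + r * Complex.exp (θ * Complex.I))) := by
            congr 1
            ext θ
            exact ENNReal.ofReal_tsum_of_nonneg (fun i => p0 i _ (hmem θ)) (hs _ (hmem θ))
        _ = ∑' i, ∫⁻ θ in Ioc 0 (2 * Real.pi),
            ENNReal.ofReal (p i (z + r * Complex.exp (θ * Complex.I))) := by
            apply lintegral_tsum
            intro i
            exact ((psi_circ_cont (hw i) _ _ hr hb).measurable.ennreal_ofReal).aemeasurable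
        _ ≤ ∑' i, ENNReal.ofReal (2 * Real.pi * p i z) := by
            apply ENNReal.tsum_le_tsum
            intro i
            rw [← ofReal_integral_eq_lintegral_ofReal]
            · apply ENNReal.ofReal_le_ofReal
              rw [← intervalIntegral.integral_of_le hpi.le]
              exact psi_mean (hw i) (hc i) hr hb
            · exact ((psi_circ_cont (hw i) _ _ hr hb).intervalIntegrable 0 (2 * Real.pi)).1
            · exact Eventually.of_forall fun θ => p0 i _ (hmem θ)
        _ = ENNReal.ofReal (2 * Real.pi * ∑' i, p i z) := by
            rw [← tsum_mul_left]
            exact (ENNReal.ofReal_tsum_of_nonneg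
              (fun i => mul_nonneg hpi.le (p0 i z hz)) ((hs z hz).mul_left _)).symm
    have : ∫ θ in Ioc 0 (2 * Real.pi), (1:ℝ) = 2 * Real.pi := by simp [hpi.le]
    rw [this]
    linarith
  · intro z hz
    have : 0 ≤ ∑' i, p i z := tsum_nonneg fun i => p0 i z hz
    show 0 < 1 + ∑' i, p i z
    linarith
  · intro i
    have h1 : p i (w i) ≤ ∑' j, p j (w i) :=
      (hs _ (hw i)).le_tsum i (fun j _ => p0 j _ (hw i))
    have h2 : p i (w i) = T i := psi_self (hc i)
    show T i ≤ 1 + ∑' j, p j (w i)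
    linarith
  · intro z hz h
    obtain ⟨B, h1, h2, h3⟩ := psum z hz
    obtain ⟨i, hi1, hi2, hi3⟩ := h3 (by linarith)
    exact ⟨i, hi1, hi2, by linarith⟩

lemma not_summable_s (s : ℝ → ℝ) (hspos : ∀ t, 0 < t → 0 < s t)
    (hsdec : ∀ t₁ t₂, 0 < t₁ → t₁ ≤ t₂ → s t₂ ≤ s t₁)
    (hsint : ∫⁻ t in Set.Ioi (1:ℝ), ENNReal.ofReal (s t) = ⊤) :
    ¬ Summable (fun n : ℕ => s (n + 1)) := by
  intro hs
  have hcov : Ioi (1:ℝ) ⊆ ⋃ n : ℕ, Ioc ((n:ℝ) + 1) (n + 2) := by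
    intro t ht
    have ht1 : (1:ℝ) < t := ht
    have h1 : 0 < ⌈t - 1⌉₊ := Nat.ceil_pos.2 (by linarith)
    obtain ⟨n, hn⟩ : ∃ n, ⌈t - 1⌉₊ = n + 1 := ⟨⌈t - 1⌉₊ - 1, by omega⟩
    rw [Nat.ceil_eq_iff (by omega)] at hn
    obtain ⟨h2, h3⟩ := hn
    simp at h2 h3
    rw [mem_iUnion]
    exact ⟨n, by linarith, by linarith⟩
  have : ∫⁻ t in Set.Ioi (1:ℝ), ENNReal.ofReal (s t) ≤ ∑' n : ℕ, ENNReal.ofReal (s (n + 1)) := by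
    calc ∫⁻ t in Set.Ioi (1:ℝ), ENNReal.ofReal (s t)
        ≤ ∫⁻ t in ⋃ n : ℕ, Ioc ((n:ℝ) + 1) (n + 2), ENNReal.ofReal (s t) :=
          lintegral_mono_set hcov
      _ ≤ ∑' n : ℕ, ∫⁻ t in Ioc ((n:ℝ) + 1) (n + 2), ENNReal.ofReal (s t) :=
          lintegral_iUnion_le _ _
      _ ≤ ∑' n : ℕ, ENNReal.ofReal (s (n + 1)) := by
          apply ENNReal.tsum_le_tsum
          intro n
          calc ∫⁻ t in Ioc ((n:ℝ) + 1) (n + 2), ENNReal.ofReal (s t)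
              ≤ ∫⁻ t in Ioc ((n:ℝ) + 1) (n + 2), ENNReal.ofReal (s (n + 1)) := by
                apply setLIntegral_mono' measurableSet_Ioc
                intro t ht
                exact ENNReal.ofReal_le_ofReal (hsdec _ _ (by positivity) ht.1.le)
            _ = ENNReal.ofReal (s (n + 1)) := by
                rw [setLIntegral_const, Real.volume_Ioc]
                norm_num
  rw [hsint, ← ENNReal.ofReal_tsum_of_nonneg (fun n => (hspos _ (by positivity)).le) hs] at this
  exact absurd this (by simp)

/-- For any decreasing `s : (0,∞) → (0,∞)` with `s(t) → 0` as `t → ∞` and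
`∫₁^∞ s = ∞`, there is a positive superharmonic `φ` on the upper half-plane whose nontangential
maximal function satisfies `|{Mφ > t}| ≤ s(t)` for all large `t`, yet `φ` has no harmonic
majorant.  (Here `Mφ(ξ) > t` is expressed as `∃ z ∈ Γ_α(ξ), φ(z) > t`.) -/
theorem statement5 (α : ℝ) (hα : 0 < α) (s : ℝ → ℝ)
    (hspos : ∀ t, 0 < t → 0 < s t)
    (hsdec : ∀ t₁ t₂, 0 < t₁ → t₁ ≤ t₂ → s t₂ ≤ s t₁)
    (hslim : Tendsto s atTop (nhds 0))
    (hsint : ∫⁻ t in Set.Ioi (1:ℝ), ENNReal.ofReal (s t) = ⊤) :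
    ∃ φ : ℂ → ℝ, SuperharmonicOnD φ upperHalf ∧ (∀ z ∈ upperHalf, 0 < φ z) ∧
      (∃ t₀ : ℝ, 0 < t₀ ∧ ∀ t, t₀ ≤ t →
        volume {ξ : ℝ | ∃ z ∈ stolz α ξ, t < φ z} ≤ ENNReal.ofReal (s t)) ∧
      ¬ ∃ h : ℂ → ℝ, HarmonicOnD h upperHalf ∧ ∀ z ∈ upperHalf, φ z ≤ h z := by
  classical
  set C : ℝ := 4 + 8 * α with hC
  have hCpos : 0 < C := by positivity
  set σ : ℕ → ℝ := fun n => min (1 / 2) (s (n + 3) / C) with hσ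
  have hσlim : Tendsto (fun n : ℕ => s (n + 3) / C) atTop (nhds 0) := by
    have : Tendsto (fun n : ℕ => (n : ℝ) + 3) atTop atTop :=
      tendsto_atTop_add_const_right _ _ tendsto_natCast_atTop_atTop
    simpa using (hslim.comp this).div_const C
  have hσanti : ∀ m n, m ≤ n → σ n ≤ σ m := by
    intro m n hmn
    apply min_le_min le_rfl
    apply div_le_div_of_nonneg_right _ hCpos.le
    apply hsdec _ _ (by positivity)
    have : (m:ℝ) ≤ n := by exact_mod_cast hmn
    linarith
  have hσpos : ∀ n, 0 < σ n := fun n =>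
    lt_min (by norm_num) (div_pos (hspos _ (by positivity)) hCpos)
  have hσns : ¬ Summable σ := by
    intro hs
    have h1 : ∀ᶠ n : ℕ in atTop, s (n + 3) / C ≤ σ n := by
      filter_upwards [hσlim.eventually (gt_mem_nhds (by norm_num : (0:ℝ) < 1 / 2))] with n hn
      exact le_min hn.le le_rfl
    have h2 : Summable (fun n : ℕ => s (n + 3) / C) := by
      obtain ⟨N, hN⟩ := eventually_atTop.1 h1
      rw [← summable_nat_add_iff N]
      exact Summable.of_nonneg_of_le
        (fun n => (div_pos (hspos _ (by positivity)) hCpos).le) (fun n => hN _ (by omega))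
        ((summable_nat_add_iff N).2 hs)
    have h3 : Summable (fun n : ℕ => s (n + 3)) := by
      refine (h2.mul_right C).congr fun n => ?_
      field_simp
    refine not_summable_s s hspos hsdec hsint ((summable_nat_add_iff 2).1 (h3.congr fun n => ?_))
    push_cast
    congr 1
    ring
  have hfind : ∀ x : ℝ, 0 < x → ∃ n, σ n ≤ x := by
    intro x hx
    obtain ⟨n, hn⟩ := (hσlim.eventually (gt_mem_nhds hx)).exists
    exact ⟨n, (min_le_right _ _).trans hn.le⟩
  set d : ℕ → ℝ := fun k => (1 / 16) * (1 / 4) ^ k with hd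
  have hdpos : ∀ k, 0 < d k := fun k => by positivity
  have hdle : ∀ k, d k ≤ 1 / 16 := fun k => by
    have : ((1:ℝ) / 4) ^ k ≤ 1 := pow_le_one₀ (by norm_num) (by norm_num)
    simp only [hd]
    linarith
  have hdlt : ∀ k l, k < l → d l ≤ d k / 4 := by
    intro k l hkl
    have : ((1:ℝ) / 4) ^ l ≤ (1 / 4) ^ (k + 1) :=
      pow_le_pow_of_le_one (by norm_num) (by norm_num) hkl
    simp only [hd]
    rw [pow_succ] at this
    linarith
  set X : ℕ × ℕ → ℝ := fun i => (i.2 + 1) * (2 * d i.1) with hX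
  have hXpos : ∀ i, 0 < X i := fun i => by
    have := hdpos i.1
    positivity
  have hXd : ∀ i, 2 * d i.1 ≤ X i := fun i => by
    have := hdpos i.1
    have h : (0:ℝ) ≤ i.2 := by positivity
    simp only [hX]
    nlinarith
  set T : ℕ × ℕ → ℕ := fun i => Nat.find (hfind (X i) (hXpos i)) with hT
  have hTlt : ∀ i n, n < T i → X i < σ n := fun i n hn =>
    not_le.1 (Nat.find_min (hfind (X i) (hXpos i)) hn)
  have hTge : ∀ i n, X i < σ n → n < T i := by
    intro i n hn
    by_contra hcon
    have h1 := hσanti _ _ (not_lt.1 hcon)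
    have h2 := Nat.find_spec (hfind (X i) (hXpos i))
    have h3 : σ (T i) ≤ X i := h2
    linarith
  have hThalf : ∀ i, 0 < T i → X i < 1 / 2 := fun i hi =>
    (hTlt i 0 hi).trans_le (min_le_left _ _)
  set w : ℕ × ℕ → ℂ := fun i => ⟨X i, 1 - √((1 - 2 * d i.1) ^ 2 - X i ^ 2)⟩ with hw
  have hwu : ∀ i, w i ∈ upperHalf := by
    intro i
    have h1 := hdpos i.1
    have h2 := hdle i.1
    have : √((1 - 2 * d i.1) ^ 2 - X i ^ 2) < 1 := by
      rw [Real.sqrt_lt' one_pos]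
      nlinarith [hXpos i]
    show (0:ℝ) < 1 - √((1 - 2 * d i.1) ^ 2 - X i ^ 2)
    linarith
  have hsq : ∀ i, X i < 1 / 2 → 0 ≤ (1 - 2 * d i.1) ^ 2 - X i ^ 2 := by
    intro i hi
    have h1 := hdpos i.1
    have h2 := hdle i.1
    nlinarith [hXpos i]
  have hwn : ∀ i, X i < 1 / 2 → ‖w i - Complex.I‖ = 1 - 2 * d i.1 := by
    intro i hi
    have h2 := hdle i.1
    rw [Complex.norm_def, Complex.normSq_apply]
    simp only [hw, Complex.sub_re, Complex.sub_im, Complex.I_re, Complex.I_im]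
    rw [Real.sqrt_eq_iff_mul_self_eq_of_pos (by linarith)]
    have := Real.mul_self_sqrt (hsq i hi)
    nlinarith
  have hwy : ∀ i, X i < 1 / 2 → (w i).im ≤ 4 * d i.1 + X i ^ 2 := by
    intro i hi
    have h1 := hdpos i.1
    have h2 := hdle i.1
    show 1 - √((1 - 2 * d i.1) ^ 2 - X i ^ 2) ≤ _
    have : (1 - 2 * d i.1) ^ 2 - X i ^ 2 ≤ √((1 - 2 * d i.1) ^ 2 - X i ^ 2) := by
      apply Real.le_sqrt_of_sq_le
      have := hsq i hi
      have : (1 - 2 * d i.1) ^ 2 - X i ^ 2 ≤ 1 := by nlinarith [hXpos i]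
      nlinarith
    nlinarith
  have hsep : ∀ k j l, j ≠ l → 2 * d k ≤ ‖w (k, j) - w (k, l)‖ := by
    intro k j l hjl
    refine le_trans ?_ (Complex.abs_re_le_norm _)
    have e : (w (k, j) - w (k, l)).re = ((j : ℝ) - l) * (2 * d k) := by
      simp only [hw, hX, Complex.sub_re]
      ring
    have h1 : (1:ℝ) ≤ |(j:ℝ) - l| := by
      have : (1:ℤ) ≤ |(j:ℤ) - l| := Int.one_le_abs (by omega)
      exact_mod_cast this
    have h2 := hdpos k
    rw [e, abs_mul, abs_of_pos (by linarith : 0 < 2 * d k)]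
    nlinarith
  obtain ⟨φ, hφ1, hφ2, hφ3, hφ4⟩ := build w hwu (fun i => (T i : ℝ)) (fun i => d i.1 / 2)
    (fun i => by positivity) (fun i => by have := hdpos i.1; positivity) (by
      intro i j z hi hj hzi hzj
      have hi' := hThalf i (by exact_mod_cast hi)
      have hj' := hThalf j (by exact_mod_cast hj)
      have B : ∀ i, X i < 1 / 2 → ‖z - w i‖ < d i.1 / 2 →
          |‖z - Complex.I‖ - (1 - 2 * d i.1)| < d i.1 / 2 := by
        intro i hi h
        rw [← hwn i hi]
        refine (abs_norm_sub_norm_le _ _).trans_lt ?_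
        simpa using h
      have bi := abs_lt.1 (B i hi' hzi)
      have bj := abs_lt.1 (B j hj' hzj)
      have pi := hdpos i.1
      have pj := hdpos j.1
      have hk : i.1 = j.1 := by
        rcases lt_trichotomy i.1 j.1 with h | h | h
        · have := hdlt _ _ h
          linarith
        · exact h
        · have := hdlt _ _ h
          linarith
      obtain ⟨k, a⟩ := i
      obtain ⟨l, b⟩ := j
      simp only at hk
      subst hk
      by_contra hne
      have hab : a ≠ b := fun h => hne (by rw [h])
      have h1 := hsep k a b hab
      have h2 : w (k, a) - w (k, b) = (z - w (k, b)) - (z - w (k, a)) := by ring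
      have h3 := norm_sub_le (z - w (k, b)) (z - w (k, a))
      rw [← h2] at h3
      simp only at hzi hzj pi
      linarith)
  refine ⟨φ, hφ1, hφ2, ⟨3, by norm_num, ?_⟩, ?_⟩
  · intro t ht
    have hst := hspos t (by linarith)
    have hsub : {ξ : ℝ | ∃ z ∈ stolz α ξ, t < φ z} ⊆ Icc (-(s t / 2)) (s t / 2) := by
      rintro ξ ⟨z, ⟨hz1, hz2⟩, hz3⟩
      obtain ⟨i, hi1, hi2, hi3⟩ := hφ4 z hz1 (by linarith)
      have hTi : 0 < T i := by exact_mod_cast hi1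
      obtain ⟨m, hm⟩ : ∃ m, T i = m + 1 := ⟨T i - 1, by omega⟩
      have hXm := hTlt i m (by omega)
      have hX2 := hThalf i hTi
      rw [hm] at hi3
      push_cast at hi3
      have h1 : X i < s t / C := by
        refine hXm.trans_le ((min_le_right _ _).trans ?_)
        apply div_le_div_of_nonneg_right _ hCpos.le
        exact hsdec _ _ (by linarith) (by linarith)
      rw [lt_div_iff₀ hCpos] at h1
      have hre := abs_le.1 ((Complex.abs_re_le_norm (z - w i)).trans hi2.le)
      have him := abs_le.1 ((Complex.abs_im_le_norm (z - w i)).trans hi2.le)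
      rw [Complex.sub_re] at hre
      rw [Complex.sub_im] at him
      have hwre : (w i).re = X i := rfl
      rw [hwre] at hre
      have hy := hwy i hX2
      have hXp := hXpos i
      have hdX := hXd i
      have hzim : z.im ≤ 4 * X i := by nlinarith
      have h2 : |z.re - ξ| ≤ 4 * α * X i := by nlinarith
      have h3 := abs_le.1 h2
      have h4 : 2 * X i + 4 * α * X i ≤ s t / 2 := by
        rw [hC] at h1
        linarith
      have := hdpos i.1
      constructor
      · linarith
      · linarith
    refine (measure_mono hsub).trans ?_
    rw [Real.volume_Icc]
    apply ENNReal.ofReal_le_ofReal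
    linarith
  · rintro ⟨h, hh, hle⟩
    apply hσns
    have h0 : ∀ z ∈ upperHalf, 0 ≤ h z := fun z hz => (hφ2 z hz).le.trans (hle z hz)
    refine summable_of_sum_range_le (c := 8 * h Complex.I) (fun n => (hσpos n).le) fun N => ?_
    have hk : ∀ k, ∑ n ∈ Finset.range N, σ n ≤ 8 * h Complex.I + 2 * N * d k := by
      intro k
      have hdk := hdpos k
      have hdk' := hdle k
      set F : Finset ℕ := (Finset.range ⌈1 / d k⌉₊).filter (fun j => X (k, j) < 1 / 2) with hF
      have main := ball_sum hh h0 hdk (by linarith) F (fun j => w (k, j))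
        (fun j => (T (k, j) : ℝ))
        (fun j hj => hwn (k, j) (Finset.mem_filter.1 hj).2)
        (fun j _ => (hφ3 (k, j)).trans (hle _ (hwu _)))
        (fun j _ l _ hjl => hsep k j l hjl)
      have hcount : ∀ j, ∑ n ∈ Finset.range N, (if X (k, j) < σ n then (1:ℝ) else 0)
          ≤ T (k, j) := by
        intro j
        rw [Finset.sum_boole]
        have : (Finset.range N).filter (fun n => X (k, j) < σ n) ⊆ Finset.range (T (k, j)) := by
          intro n hn
          exact Finset.mem_range.2 (hTge _ _ (Finset.mem_filter.1 hn).2)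
        have := Finset.card_le_card this
        rw [Finset.card_range] at this
        exact_mod_cast this
      have hcol : ∀ n, σ n / 2 - d k
          ≤ (∑ j ∈ F, (if X (k, j) < σ n then (1:ℝ) else 0)) * d k := by
        intro n
        have hσ2 : σ n ≤ 1 / 2 := min_le_left _ _
        have hσp := hσpos n
        rw [Finset.sum_boole]
        set M := ⌈σ n / (2 * d k)⌉₊ with hM
        have hM1 : σ n / (2 * d k) ≤ M := Nat.le_ceil _
        have hM2 : (M : ℝ) < σ n / (2 * d k) + 1 := Nat.ceil_lt_add_one (by positivity)
        have hsub : Finset.range (M - 1) ⊆ F.filter (fun j => X (k, j) < σ n) := by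
          intro j hj
          rw [Finset.mem_range] at hj
          have hj2 : (j : ℝ) + 2 ≤ M := by exact_mod_cast (by omega : j + 2 ≤ M)
          have hj3 : (j : ℝ) + 1 < σ n / (2 * d k) := by linarith
          have hXj : X (k, j) < σ n := by
            rw [lt_div_iff₀ (by positivity)] at hj3
            exact hj3
          rw [Finset.mem_filter, hF, Finset.mem_filter, Finset.mem_range]
          refine ⟨⟨?_, by linarith⟩, hXj⟩
          rw [Nat.lt_ceil, lt_div_iff₀ hdk]
          have : ((j:ℝ) + 1) * (2 * d k) < σ n := hXj
          have hj0 : (0:ℝ) ≤ j := by positivity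
          nlinarith
        have hcard := Finset.card_le_card hsub
        rw [Finset.card_range] at hcard
        have hcard' : (M : ℝ) ≤ (F.filter (fun j => X (k, j) < σ n)).card + 1 := by
          exact_mod_cast (by omega : M ≤ (F.filter (fun j => X (k, j) < σ n)).card + 1)
        rw [div_le_iff₀ (by positivity)] at hM1
        nlinarith
      have h1 : ∑ n ∈ Finset.range N, (σ n / 2 - d k) ≤ 4 * h Complex.I := by
        calc ∑ n ∈ Finset.range N, (σ n / 2 - d k)
            ≤ ∑ n ∈ Finset.range N,
              (∑ j ∈ F, (if X (k, j) < σ n then (1:ℝ) else 0)) * d k :=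
              Finset.sum_le_sum fun n _ => hcol n
          _ = ∑ j ∈ F, (∑ n ∈ Finset.range N, (if X (k, j) < σ n then (1:ℝ) else 0)) * d k := by
              rw [← Finset.sum_mul, ← Finset.sum_mul, Finset.sum_comm]
          _ ≤ ∑ j ∈ F, (T (k, j) : ℝ) * d k :=
              Finset.sum_le_sum fun j _ => mul_le_mul_of_nonneg_right (hcount j) hdk.le
          _ ≤ 4 * h Complex.I := main
      rw [Finset.sum_sub_distrib, ← Finset.sum_div, Finset.sum_const, Finset.card_range,
        nsmul_eq_mul] at h1
      linarith
    have hdlim : Tendsto (fun k => 8 * h Complex.I + 2 * N * d k) atTop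
        (nhds (8 * h Complex.I + 2 * N * ((1 / 16) * 0))) :=
      (((tendsto_pow_atTop_nhds_zero_of_lt_one (by norm_num) (by norm_num)).const_mul
        (1 / 16)).const_mul _).const_add _
    have := ge_of_tendsto' hdlim hk
    simpa using this
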